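/- (99%-structured inverse theorem for the Gowers norms) For every d ≥ 1 and every 0 < ε < 1 there exists 0 < δ < 1, depending only on d and ε, with the following property: for every n ≥ 1 and every f: F₂ⁿ → [−1,1] with ‖f‖_{U^d(F₂ⁿ)} ≥ 1 − δ, there exists a Reed-Muller code g: F₂ⁿ → {−1,1} of order at most d−1 such that ⟨f, g⟩ := E_{x ∈ F₂ⁿ} f(x)g(x) ≥ 1 − ε. -/

import Mathlib

/-- The `2^d`-th power of the Gowers uniformity norm `‖f‖_{U^d(F₂ⁿ)}`:
the average of `∏_{ω ∈ {0,1}^d} f(x + ω₁h₁ + ⋯ + ω_dh_d)` over `x, h₁, …, h_d ∈ F₂ⁿ`. -/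
noncomputable def gowersPow (n d : ℕ) (f : (Fin n → ZMod 2) → ℝ) : ℝ :=
  (∑ x : Fin n → ZMod 2, ∑ h : Fin d → (Fin n → ZMod 2),
      ∏ ω : Fin d → ZMod 2, f (x + ∑ i, ω i • h i)) /
    ((Fintype.card (Fin n → ZMod 2) : ℝ) *
      (Fintype.card (Fin d → (Fin n → ZMod 2)) : ℝ))

/-- The Gowers uniformity norm `‖f‖_{U^d(F₂ⁿ)}`, the nonnegative `2^d`-th root of
the Gowers average `gowersPow n d f`. -/
noncomputable def gowersNorm (n d : ℕ) (f : (Fin n → ZMod 2) → ℝ) : ℝ :=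
  Real.rpow (gowersPow n d f) ((2 : ℝ) ^ d)⁻¹


section Helpers

open Classical in
/-- uniform probability on a finite type -/
noncomputable def unifPr {α : Type*} [Fintype α] (p : α → Prop) : ℝ :=
  ((Finset.univ.filter p).card : ℝ) / (Fintype.card α : ℝ)

lemma unifPr_mono {α : Type*} [Fintype α] {p q : α → Prop} (h : ∀ a, p a → q a) :
    unifPr p ≤ unifPr q := by
  classical
  unfold unifPr
  gcongr
  exact h _

lemma unifPr_eq_sum {α : Type*} [Fintype α] (p : α → Prop) [DecidablePred p] :
    unifPr p = (∑ a, if p a then (1 : ℝ) else 0) / (Fintype.card α : ℝ) := by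
  unfold unifPr
  rw [Finset.sum_boole]
  congr!

lemma unifPr_or_le {α : Type*} [Fintype α] (p q : α → Prop) :
    unifPr (fun a => p a ∨ q a) ≤ unifPr p + unifPr q := by
  classical
  rw [unifPr_eq_sum, unifPr_eq_sum, unifPr_eq_sum, ← add_div, ← Finset.sum_add_distrib]
  refine div_le_div_of_nonneg_right (Finset.sum_le_sum fun a _ => ?_) (by positivity)
  by_cases h1 : p a <;> by_cases h2 : q a <;> simp [h1, h2]

lemma unifPr_exists_le {α ι : Type*} [Fintype α] [Fintype ι] (p : ι → α → Prop) (c : ℝ)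
    (hc : ∀ i, unifPr (p i) ≤ c) :
    unifPr (fun a => ∃ i, p i a) ≤ Fintype.card ι * c := by
  classical
  have h1 : unifPr (fun a => ∃ i, p i a) ≤ ∑ i, unifPr (p i) := by
    unfold unifPr
    rw [← Finset.sum_div]
    gcongr
    have : (Finset.univ.filter (fun a => ∃ i, p i a))
        ⊆ Finset.univ.biUnion (fun i => Finset.univ.filter (p i)) := by
      intro a; simp
    have h2 := (Finset.card_le_card this).trans Finset.card_biUnion_le
    have h3 : ((Finset.univ.filter (fun a => ∃ i, p i a)).card : ℝ)
        ≤ ∑ i, ((Finset.univ.filter (p i)).card : ℝ) := by exact_mod_cast h2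
    refine le_trans (le_of_eq ?_) h3
    congr!
  refine h1.trans ((Finset.sum_le_sum (fun i _ => hc i)).trans ?_)
  simp

lemma unifPr_lt_one {α : Type*} [Fintype α] [Nonempty α] {p : α → Prop} (h : unifPr p < 1) :
    ∃ a, ¬ p a := by
  classical
  by_contra! H
  unfold unifPr at h
  rw [Finset.filter_true_of_mem (fun a _ => H a), Finset.card_univ, div_self (by positivity)] at h
  exact lt_irrefl _ h

lemma unifPr_prod {α β : Type*} [Fintype α] [Fintype β] (p : α × β → Prop) :
    unifPr p = (∑ a, unifPr (fun b => p (a, b))) / (Fintype.card α : ℝ) := by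
  classical
  simp only [unifPr_eq_sum]
  rw [← Finset.sum_div, Fintype.sum_prod_type, Fintype.card_prod]
  push_cast
  rw [div_div, mul_comm]

lemma unifPr_prod_le {α β : Type*} [Fintype α] [Nonempty α] [Fintype β] (p : α × β → Prop) (c : ℝ)
    (h : ∀ a, unifPr (fun b => p (a, b)) ≤ c) : unifPr p ≤ c := by
  rw [unifPr_prod, div_le_iff₀ (by positivity)]
  refine (Finset.sum_le_sum (fun i _ => h i)).trans ?_
  simp [mul_comm]

lemma unifPr_exists_fiber {α β : Type*} [Fintype α] [Nonempty α] [Fintype β]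
    (p : α × β → Prop) (c : ℝ)
    (h : unifPr p ≤ c) : ∃ a, unifPr (fun b => p (a, b)) ≤ c := by
  by_contra! H
  rw [unifPr_prod, div_le_iff₀ (by positivity)] at h
  have := Finset.sum_lt_sum_of_nonempty (Finset.univ_nonempty (α := α)) (fun i _ => H i)
  simp at this
  linarith [mul_comm c (Fintype.card α : ℝ)]

lemma unifPr_map {A B : Type*} [AddCommGroup A] [AddCommGroup B] [Fintype A] [Fintype B]
    (φ : A →+ B) (hφ : Function.Surjective φ) (c : B) (p : B → Prop) :
    unifPr (fun a => p (c + φ a)) = unifPr p := by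
  classical
  have key : ∀ q : B → ℝ, (∑ a, q (φ a)) / (Fintype.card A : ℝ)
      = (∑ b, q b) / (Fintype.card B : ℝ) := by
    intro q
    have hf : ∀ b, (Finset.univ.filter (fun a => φ a = b)).card
        = (Finset.univ.filter (fun a => φ a = 0)).card := fun b =>
      AddMonoidHom.card_fiber_eq_of_mem_range φ (hφ b) (hφ 0)
    set K := (Finset.univ.filter (fun a => φ a = 0)).card with hK
    have h1 : ∀ q : B → ℝ, ∑ a, q (φ a) = K * ∑ b, q b := by
      intro q
      rw [← Finset.sum_fiberwise_of_maps_to (t := Finset.univ) (g := φ) (fun _ _ => Finset.mem_univ _),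
        Finset.mul_sum]
      refine Finset.sum_congr rfl fun b _ => ?_
      rw [Finset.sum_congr rfl (g := fun _ => q b)]
      · rw [Finset.sum_const, hf, nsmul_eq_mul]
      · intro a ha
        rw [(Finset.mem_filter.1 ha).2]
    have h2 : (Fintype.card A : ℝ) = K * Fintype.card B := by
      have := h1 (fun _ => 1)
      simpa using this
    have hK0 : (K : ℝ) ≠ 0 := by
      have : (Fintype.card A : ℝ) ≠ 0 := by positivity
      intro h0
      rw [h2, h0] at this
      simp at this
    rw [h1, h2, mul_div_mul_left _ _ hK0]
  rw [unifPr_eq_sum, unifPr_eq_sum]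
  rw [key (fun b => if p (c + b) then (1 : ℝ) else 0)]
  congr 1
  exact Equiv.sum_comp (Equiv.addLeft c) (fun b => if p b then (1 : ℝ) else 0)

/-- iterated derivative -/
def cubeSum {V ι : Type*} [AddCommGroup V] [Module (ZMod 2) V] [Fintype ι] [DecidableEq ι]
    (F : V → ZMod 2) (x : V) (h : ι → V) : ZMod 2 :=
  ∑ ω : ι → ZMod 2, F (x + ∑ i, ω i • h i)

/-- punctured cube sum -/
def punctSum {V ι : Type*} [AddCommGroup V] [Module (ZMod 2) V] [Fintype ι] [DecidableEq ι]
    (F : V → ZMod 2) (x : V) (h : ι → V) : ZMod 2 :=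
  ∑ ω ∈ Finset.univ.erase (0 : ι → ZMod 2), F (x + ∑ i, ω i • h i)

lemma cubeSum_eq {V ι : Type*} [AddCommGroup V] [Module (ZMod 2) V] [Fintype ι] [DecidableEq ι]
    (F : V → ZMod 2) (x : V) (h : ι → V) : cubeSum F x h = F x + punctSum F x h := by
  unfold cubeSum punctSum
  rw [← Finset.add_sum_erase _ _ (Finset.mem_univ (0 : ι → ZMod 2))]
  simp

lemma exists_coord_one {ι : Type*} {ω : ι → ZMod 2} (h : ω ≠ 0) : ∃ i, ω i = 1 := by
  obtain ⟨i, hi⟩ := Function.ne_iff.1 h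
  refine ⟨i, ?_⟩
  have : ∀ a : ZMod 2, a ≠ 0 → a = 1 := by decide
  exact this _ hi

lemma sum_smul_single {V ι : Type*} [AddCommGroup V] [Module (ZMod 2) V] [Fintype ι]
    [DecidableEq ι] (ω : ι → ZMod 2) (i : ι) (hi : ω i = 1) (v : V) :
    ∑ j, ω j • (Pi.single i v : ι → V) j = v := by
  rw [Finset.sum_eq_single i]
  · simp [hi]
  · intro b _ hb
    simp [hb]
  · simp

/-- linear combination hom -/
def combHom {V : Type*} [AddCommGroup V] [Module (ZMod 2) V] {ι : Type*} [Fintype ι]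
    (ω : ι → ZMod 2) : (ι → V) →+ V :=
  AddMonoidHom.mk' (fun h => ∑ i, ω i • h i) (by
    intro a b
    simp [Finset.sum_add_distrib])

lemma combHom_apply {V : Type*} [AddCommGroup V] [Module (ZMod 2) V] {ι : Type*} [Fintype ι]
    (ω : ι → ZMod 2) (h : ι → V) : combHom ω h = ∑ i, ω i • h i := rfl

lemma zmod2_add_eq_zero {a b : ZMod 2} : a + b = 0 ↔ a = b := by
  revert a b; decide

section Correct

variable {V ι : Type*} [AddCommGroup V] [Module (ZMod 2) V] [Fintype V] [Fintype ι]
  [DecidableEq ι]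

lemma punct_collision (F : V → ZMod 2) (η : ℝ)
    (hF : unifPr (fun z : V × (ι → V) => cubeSum F z.1 z.2 ≠ 0) ≤ η) (x : V) :
    unifPr (fun z : (ι → V) × (ι → V) => punctSum F x z.1 ≠ punctSum F x z.2)
      ≤ 2 * (Fintype.card (ι → ZMod 2) * η) := by
  have hη : 0 ≤ η := le_trans (by unfold unifPr; positivity) hF
  let B1 : (ι → ZMod 2) → (ι → V) × (ι → V) → Prop := fun ω z =>
    ω ≠ 0 ∧ cubeSum F (x + ∑ i, ω i • z.1 i) z.2 ≠ 0
  let B2 : (ι → ZMod 2) → (ι → V) × (ι → V) → Prop := fun ω z =>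
    ω ≠ 0 ∧ cubeSum F (x + ∑ i, ω i • z.2 i) z.1 ≠ 0
  have h1 : ∀ ω, unifPr (B1 ω) ≤ η := by
    intro ω
    by_cases hω : ω = 0
    · have : unifPr (B1 ω) = 0 := by simp [B1, hω, unifPr]
      rw [this]; exact hη
    obtain ⟨i, hi⟩ := exists_coord_one hω
    let φ : (ι → V) × (ι → V) →+ V × (ι → V) :=
      AddMonoidHom.prodMap (combHom ω) (AddMonoidHom.id _)
    have hs : Function.Surjective φ := by
      rintro ⟨v, w⟩
      refine ⟨(Pi.single i v, w), ?_⟩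
      simp [φ, combHom_apply, sum_smul_single ω i hi v]
    refine le_trans ?_ hF
    rw [← unifPr_map φ hs (x, 0)]
    refine unifPr_mono fun z hz => ?_
    simpa [φ, combHom_apply] using hz.2
  have h2 : ∀ ω, unifPr (B2 ω) ≤ η := by
    intro ω
    by_cases hω : ω = 0
    · have : unifPr (B2 ω) = 0 := by simp [B2, hω, unifPr]
      rw [this]; exact hη
    obtain ⟨i, hi⟩ := exists_coord_one hω
    let φ : (ι → V) × (ι → V) →+ V × (ι → V) :=
      AddMonoidHom.prod ((combHom ω).comp (AddMonoidHom.snd _ _)) (AddMonoidHom.fst _ _)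
    have hs : Function.Surjective φ := by
      rintro ⟨v, w⟩
      refine ⟨(w, Pi.single i v), ?_⟩
      simp [φ, combHom_apply, sum_smul_single ω i hi v]
    refine le_trans ?_ hF
    rw [← unifPr_map φ hs (x, 0)]
    refine unifPr_mono fun z hz => ?_
    simpa [φ, combHom_apply] using hz.2
  have h3 := unifPr_or_le (fun z => ∃ ω, B1 ω z) (fun z => ∃ ω, B2 ω z)
  have h4 := unifPr_exists_le B1 η h1
  have h5 := unifPr_exists_le B2 η h2
  have h6 : unifPr (fun z : (ι → V) × (ι → V) => punctSum F x z.1 ≠ punctSum F x z.2)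
      ≤ unifPr (fun z => (∃ ω, B1 ω z) ∨ (∃ ω, B2 ω z)) := by
    refine unifPr_mono fun z hz => ?_
    by_contra! H
    obtain ⟨H1, H2⟩ := H
    apply hz
    have e1 : ∑ ω ∈ Finset.univ.erase (0 : ι → ZMod 2), cubeSum F (x + ∑ i, ω i • z.1 i) z.2 = 0 := by
      refine Finset.sum_eq_zero fun ω hω => ?_
      by_contra hh
      exact H1 ω ⟨Finset.ne_of_mem_erase hω, hh⟩
    have e2 : ∑ ω ∈ Finset.univ.erase (0 : ι → ZMod 2), cubeSum F (x + ∑ i, ω i • z.2 i) z.1 = 0 := by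
      refine Finset.sum_eq_zero fun ω hω => ?_
      by_contra hh
      exact H2 ω ⟨Finset.ne_of_mem_erase hω, hh⟩
    simp only [cubeSum_eq, Finset.sum_add_distrib] at e1 e2
    have e3 : ∑ ω ∈ Finset.univ.erase (0 : ι → ZMod 2), punctSum F (x + ∑ i, ω i • z.1 i) z.2
        = ∑ ω ∈ Finset.univ.erase (0 : ι → ZMod 2), punctSum F (x + ∑ i, ω i • z.2 i) z.1 := by
      unfold punctSum
      rw [Finset.sum_comm]
      refine Finset.sum_congr rfl fun a _ => Finset.sum_congr rfl fun b _ => ?_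
      rw [add_right_comm]
    rw [e3] at e1
    exact (add_right_cancel (e1.trans e2.symm))
  linarith

lemma exists_corrected (F : V → ZMod 2) (η : ℝ)
    (hF : unifPr (fun z : V × (ι → V) => cubeSum F z.1 z.2 ≠ 0) ≤ η)
    (hη : Fintype.card (ι → ZMod 2) * (2 * (Fintype.card (ι → ZMod 2) * η))
      + Fintype.card (ι → ZMod 2) * η < 1) :
    ∃ P : V → ZMod 2, (∀ (x : V) (h : ι → V), cubeSum P x h = 0) ∧
      unifPr (fun x => F x ≠ P x) ≤ η + 2 * (Fintype.card (ι → ZMod 2) * η) := by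
  have hη0 : 0 ≤ η := le_trans (by unfold unifPr; positivity) hF
  set M : ℝ := (Fintype.card (ι → ZMod 2) : ℝ) with hM
  have h0 : ∀ x : V, ∃ a : ZMod 2, unifPr (fun h : ι → V => a ≠ punctSum F x h) ≤ 2 * (M * η) := by
    intro x
    obtain ⟨h', hh⟩ := unifPr_exists_fiber
      (fun z : (ι → V) × (ι → V) => punctSum F x z.1 ≠ punctSum F x z.2) _
      (punct_collision F η hF x)
    exact ⟨punctSum F x h', hh⟩
  choose P hP using h0
  refine ⟨P, fun x h => ?_, ?_⟩
  · let B1 : (ι → ZMod 2) → (ι → V) × (ι → ι → V) → Prop := fun ω z =>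
      P (x + ∑ i, ω i • h i) ≠ punctSum F (x + ∑ i, ω i • h i) (z.1 + ∑ i, ω i • z.2 i)
    let B2 : (ι → ZMod 2) → (ι → V) × (ι → ι → V) → Prop := fun ω' z =>
      ω' ≠ 0 ∧ cubeSum F (x + ∑ j, ω' j • z.1 j) (fun i => h i + ∑ j, ω' j • z.2 i j) ≠ 0
    have h1 : ∀ ω, unifPr (B1 ω) ≤ 2 * (M * η) := by
      intro ω
      let φ : (ι → V) × (ι → ι → V) →+ (ι → V) :=
        AddMonoidHom.coprod (AddMonoidHom.id _) (combHom ω)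
      have hs : Function.Surjective φ := fun v => ⟨(v, 0), by simp [φ]⟩
      refine le_trans ?_ (hP (x + ∑ i, ω i • h i))
      rw [← unifPr_map φ hs 0]
      refine unifPr_mono fun z hz => ?_
      simpa [φ, combHom_apply] using hz
    have h2 : ∀ ω, unifPr (B2 ω) ≤ η := by
      intro ω
      by_cases hω : ω = 0
      · have : unifPr (B2 ω) = 0 := by simp [B2, hω, unifPr]
        rw [this]; exact hη0
      obtain ⟨i, hi⟩ := exists_coord_one hω
      let φ : (ι → V) × (ι → ι → V) →+ V × (ι → V) :=
        AddMonoidHom.prodMap (combHom ω) ((combHom ω).compLeft ι)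
      have hs : Function.Surjective φ := by
        rintro ⟨v, w⟩
        refine ⟨(Pi.single i v, fun j => Pi.single i (w j)), ?_⟩
        refine Prod.ext ?_ (funext fun j => ?_)
        · exact sum_smul_single ω i hi v
        · exact sum_smul_single ω i hi (w j)
      refine le_trans ?_ hF
      rw [← unifPr_map φ hs (x, h)]
      exact unifPr_mono fun z hz => hz.2
    have h3 := unifPr_or_le (fun z => ∃ ω, B1 ω z) (fun z => ∃ ω, B2 ω z)
    have h4 := unifPr_exists_le B1 _ h1
    have h5 := unifPr_exists_le B2 η h2
    obtain ⟨z, hz⟩ := unifPr_lt_one (lt_of_le_of_lt (h3.trans (add_le_add h4 h5)) hη)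
    push Not at hz
    obtain ⟨H1, H2⟩ := hz
    have H1' : ∀ ω : ι → ZMod 2, P (x + ∑ i, ω i • h i)
        = punctSum F (x + ∑ i, ω i • h i) (z.1 + ∑ i, ω i • z.2 i) := by
      intro ω; by_contra hh; exact H1 ω hh
    have H2' : ∀ ω' : ι → ZMod 2, ω' ≠ 0 →
        cubeSum F (x + ∑ j, ω' j • z.1 j) (fun i => h i + ∑ j, ω' j • z.2 i j) = 0 := by
      intro ω' hω; by_contra hh; exact H2 ω' ⟨hω, hh⟩
    unfold cubeSum
    simp only [H1']
    unfold punctSum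
    rw [Finset.sum_comm]
    refine Finset.sum_eq_zero fun ω' hω' => ?_
    rw [← H2' ω' (Finset.ne_of_mem_erase hω')]
    unfold cubeSum
    refine Finset.sum_congr rfl fun ω _ => ?_
    congr 1
    simp only [Pi.add_apply, Finset.sum_apply, Pi.smul_apply, smul_add, Finset.sum_add_distrib,
      Finset.smul_sum]
    rw [Finset.sum_comm (f := fun i j => ω' i • ω j • z.2 j i)]
    simp only [smul_comm (ω' _) (ω _)]
    abel
  · let φ : V × (ι → V) →+ V := AddMonoidHom.fst _ _
    have hs : Function.Surjective φ := fun v => ⟨(v, 0), rfl⟩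
    rw [← unifPr_map φ hs 0]
    have a1 : unifPr (fun z : V × (ι → V) => P z.1 ≠ punctSum F z.1 z.2) ≤ 2 * (M * η) :=
      unifPr_prod_le _ _ hP
    have a2 := unifPr_or_le (fun z : V × (ι → V) => cubeSum F z.1 z.2 ≠ 0)
      (fun z : V × (ι → V) => P z.1 ≠ punctSum F z.1 z.2)
    refine le_trans (unifPr_mono fun z hz => ?_) (a2.trans (add_le_add hF a1))
    by_contra! H
    obtain ⟨e1, e2⟩ := H
    rw [cubeSum_eq, zmod2_add_eq_zero] at e1
    apply hz
    simp [φ, e1, e2]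

end Correct

lemma cubeSum_of_le {V : Type*} [AddCommGroup V] [Module (ZMod 2) V] (p : V → ZMod 2) (d : ℕ)
    (hp : ∀ (x : V) (h : Fin d → V), cubeSum p x h = 0) (m : ℕ) (hm : d ≤ m) :
    ∀ (x : V) (h : Fin m → V), cubeSum p x h = 0 := by
  induction m, hm using Nat.le_induction with
  | base => exact hp
  | succ m hm ih =>
    intro x h
    unfold cubeSum
    rw [← (Fin.consEquiv (fun _ : Fin (m + 1) => ZMod 2)).sum_comp, Fintype.sum_prod_type]
    refine Finset.sum_eq_zero fun a _ => ?_
    rw [← ih (x + a • h 0) (fun i => h i.succ)]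
    unfold cubeSum
    refine Finset.sum_congr rfl fun ω _ => ?_
    simp [Fin.consEquiv, Fin.sum_univ_succ, add_assoc]

lemma cubeSum_of_card {V ι : Type*} [AddCommGroup V] [Module (ZMod 2) V] [Fintype ι]
    [DecidableEq ι] (p : V → ZMod 2) (d : ℕ)
    (hp : ∀ (x : V) (h : Fin d → V), cubeSum p x h = 0) (hm : d ≤ Fintype.card ι)
    (x : V) (h : ι → V) : cubeSum p x h = 0 := by
  let e := Fintype.equivFin ι
  rw [← cubeSum_of_le p d hp _ hm x (fun i => h (e.symm i))]
  unfold cubeSum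
  rw [← (Equiv.arrowCongr e (Equiv.refl (ZMod 2))).sum_comp]
  refine Finset.sum_congr rfl fun ω _ => ?_
  congr 2
  rw [← e.sum_comp]
  simp

lemma exists_poly (n d : ℕ) (hd : 1 ≤ d) (p : (Fin n → ZMod 2) → ZMod 2)
    (hp : ∀ (x : Fin n → ZMod 2) (h : Fin d → Fin n → ZMod 2), cubeSum p x h = 0) :
    ∃ Q : MvPolynomial (Fin n) (ZMod 2), Q.totalDegree ≤ d - 1 ∧
      ∀ x, MvPolynomial.eval x Q = p x := by
  classical
  let c : Finset (Fin n) → ZMod 2 := fun S => ∑ y, p y * ∏ i ∈ Finset.univ \ S, (1 + y i)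
  have hc : ∀ S : Finset (Fin n), d ≤ S.card → c S = 0 := by
    intro S hS
    rw [← cubeSum_of_card (ι := S) p d hp (by simpa using hS) 0
      (fun i => Pi.single (i : Fin n) (1 : ZMod 2))]
    unfold cubeSum
    have ev : ∀ (ω : S → ZMod 2) (j : Fin n),
        (0 + ∑ i, ω i • (Pi.single (i : Fin n) (1 : ZMod 2) : Fin n → ZMod 2)) j
          = if hj : j ∈ S then ω ⟨j, hj⟩ else 0 := by
      intro ω j
      simp only [zero_add, Finset.sum_apply, Pi.smul_apply, smul_eq_mul]
      split_ifs with hj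
      · rw [Finset.sum_eq_single ⟨j, hj⟩]
        · simp
        · intro b _ hb
          have : j ≠ b := fun h => hb (Subtype.ext h.symm)
          simp [this]
        · simp
      · refine Finset.sum_eq_zero fun b _ => ?_
        have : j ≠ b := fun h => hj (h ▸ b.2)
        simp [this]
    symm
    refine Fintype.sum_of_injective
      (fun ω : S → ZMod 2 => 0 + ∑ i, ω i • (Pi.single (i : Fin n) (1 : ZMod 2) : Fin n → ZMod 2))
      ?_ _ _ ?_ ?_
    · intro ω ω' h
      funext j
      have := congrFun h j
      simp only [ev] at this
      simpa using this
    · intro y hy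
      have : ∃ j ∉ S, y j = 1 := by
        by_contra! H
        apply hy
        refine ⟨fun i => y i, ?_⟩
        funext j
        simp only [ev]
        split_ifs with hj
        · rfl
        · have h2 : ∀ a : ZMod 2, a ≠ 1 → 0 = a := by decide
          exact h2 _ (H j hj)
      obtain ⟨j, hj, hy1⟩ := this
      rw [Finset.prod_eq_zero (i := j) (by simp [hj])]
      · simp
      · rw [hy1]; decide
    · intro ω
      rw [Finset.prod_eq_one, mul_one]
      intro j hj
      rw [ev, dif_neg (by simpa using hj), add_zero]
  refine ⟨∑ S ∈ Finset.univ.filter (fun S : Finset (Fin n) => S.card < d),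
    MvPolynomial.C (c S) * ∏ i ∈ S, MvPolynomial.X i, ?_, fun x => ?_⟩
  · refine MvPolynomial.totalDegree_finsetSum_le fun S hS => ?_
    refine (MvPolynomial.totalDegree_mul _ _).trans ?_
    rw [MvPolynomial.totalDegree_C, zero_add]
    refine (MvPolynomial.totalDegree_finsetProd _ _).trans ?_
    simp only [MvPolynomial.totalDegree_X, Finset.sum_const, smul_eq_mul, mul_one]
    have := (Finset.mem_filter.1 hS).2
    omega
  · simp only [map_sum, map_mul, map_prod, MvPolynomial.eval_C, MvPolynomial.eval_X]
    rw [Finset.sum_filter_of_ne]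
    · have h1 : ∀ y : Fin n → ZMod 2, ∏ i, (x i + (1 + y i)) = if y = x then 1 else 0 := by
        intro y
        split_ifs with h
        · subst h
          refine Finset.prod_eq_one fun i _ => ?_
          have : ∀ a : ZMod 2, a + (1 + a) = 1 := by decide
          exact this _
        · obtain ⟨i, hi⟩ := Function.ne_iff.1 h
          refine Finset.prod_eq_zero (Finset.mem_univ i) ?_
          have : ∀ a b : ZMod 2, a ≠ b → b + (1 + a) = 0 := by decide
          exact this _ _ hi
      have h2 : p x = ∑ y, p y * ∏ i, (x i + (1 + y i)) := by
        simp [h1]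
      rw [h2]
      have h3 : ∀ y : Fin n → ZMod 2, ∏ i, (x i + (1 + y i))
          = ∑ S : Finset (Fin n), (∏ i ∈ S, x i) * ∏ i ∈ Finset.univ \ S, (1 + y i) := by
        intro y
        rw [Finset.prod_add, Finset.powerset_univ]
      simp only [h3, c, Finset.sum_mul, Finset.mul_sum]
      rw [Finset.sum_comm]
      refine Finset.sum_congr rfl fun y _ => Finset.sum_congr rfl fun S _ => ?_
      ring
    · intro S _ hne
      by_contra hlt
      exact hne (by rw [hc S (not_lt.1 hlt), zero_mul])

lemma neg_one_sum {α : Type*} (s : Finset α) (F : α → ZMod 2) :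
    (-1 : ℝ) ^ (∑ a ∈ s, F a).val = ∏ a ∈ s, (-1 : ℝ) ^ (F a).val := by
  classical
  have key : ∀ a b : ZMod 2, (-1 : ℝ) ^ (a + b).val = (-1 : ℝ) ^ a.val * (-1 : ℝ) ^ b.val := by
    intro a b
    rw [← pow_add, neg_one_pow_eq_pow_mod_two, neg_one_pow_eq_pow_mod_two (n := a.val + b.val),
      ZMod.val_add, Nat.mod_mod]
  induction s using Finset.induction_on with
  | empty => simp
  | insert a s ha ih => rw [Finset.sum_insert ha, Finset.prod_insert ha, key, ih]

/-- sign pattern of a function -/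
noncomputable def sgnBit {V : Type*} (f : V → ℝ) (x : V) : ZMod 2 := if f x < 0 then 1 else 0

lemma sgnBit_mul {V : Type*} (f : V → ℝ) (x : V) :
    f x = |f x| * (-1 : ℝ) ^ (sgnBit f x).val := by
  unfold sgnBit
  split_ifs with h
  · rw [abs_of_neg h]; simp [ZMod.val_one]
  · rw [abs_of_nonneg (not_lt.1 h)]; simp

lemma core (n d : ℕ) (hd : 1 ≤ d) (η : ℝ)
    (f : (Fin n → ZMod 2) → ℝ) (hf : ∀ x, |f x| ≤ 1)
    (hη : Fintype.card (Fin d → ZMod 2) * (2 * (Fintype.card (Fin d → ZMod 2) * η))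
      + Fintype.card (Fin d → ZMod 2) * η < 1)
    (hA : 1 - η ≤ gowersPow n d f) :
    ∃ P : MvPolynomial (Fin n) (ZMod 2), P.totalDegree ≤ d - 1 ∧
      1 - (3 * η + 4 * (Fintype.card (Fin d → ZMod 2) * η)) ≤ (∑ x : Fin n → ZMod 2,
              f x * (-1 : ℝ) ^ (MvPolynomial.eval x P).val) /
            (Fintype.card (Fin n → ZMod 2) : ℝ) := by
  classical
  set M : ℝ := (Fintype.card (Fin d → ZMod 2) : ℝ) with hM
  let G : (Fin n → ZMod 2) × (Fin d → (Fin n → ZMod 2)) → ℝ := fun z => ∏ ω : Fin d → ZMod 2, f (z.1 + ∑ i, ω i • z.2 i)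
  have hG : gowersPow n d f = (∑ z, G z) / (Fintype.card ((Fin n → ZMod 2) × (Fin d → (Fin n → ZMod 2))) : ℝ) := by
    unfold gowersPow
    rw [Fintype.sum_prod_type, Fintype.card_prod]
    push_cast
    rfl
  have hGabs : ∀ z, |G z| ≤ |f z.1| := by
    intro z
    simp only [G, Finset.abs_prod]
    rw [← Finset.mul_prod_erase _ _ (Finset.mem_univ (0 : Fin d → ZMod 2))]
    simp only [Pi.zero_apply, zero_smul, Finset.sum_const_zero, add_zero]
    refine mul_le_of_le_one_right (abs_nonneg _) ?_
    exact Finset.prod_le_one (fun _ _ => abs_nonneg _) (fun _ _ => hf _)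
  have hbad : ∀ z : (Fin n → ZMod 2) × (Fin d → (Fin n → ZMod 2)), cubeSum (sgnBit f) z.1 z.2 ≠ 0 → G z ≤ 0 := by
    intro z hz
    have h1 : cubeSum (sgnBit f) z.1 z.2 = 1 := by
      have : ∀ a : ZMod 2, a ≠ 0 → a = 1 := by decide
      exact this _ hz
    have h2 : G z = (∏ ω : Fin d → ZMod 2, |f (z.1 + ∑ i, ω i • z.2 i)|)
        * (-1 : ℝ) ^ (cubeSum (sgnBit f) z.1 z.2).val := by
      unfold cubeSum
      rw [neg_one_sum, ← Finset.prod_mul_distrib]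
      exact Finset.prod_congr rfl fun ω _ => sgnBit_mul f _
    rw [h2, h1]
    have : 0 ≤ ∏ ω : Fin d → ZMod 2, |f (z.1 + ∑ i, ω i • z.2 i)| :=
      Finset.prod_nonneg fun _ _ => abs_nonneg _
    simpa [ZMod.val_one] using this
  have hpr : unifPr (fun z : (Fin n → ZMod 2) × (Fin d → (Fin n → ZMod 2)) => cubeSum (sgnBit f) z.1 z.2 ≠ 0) ≤ η := by
    have h1 : ∑ z, G z ≤ ∑ z : (Fin n → ZMod 2) × (Fin d → (Fin n → ZMod 2)),
        (1 - if cubeSum (sgnBit f) z.1 z.2 ≠ 0 then (1 : ℝ) else 0) := by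
      refine Finset.sum_le_sum fun z _ => ?_
      split_ifs with h
      · linarith [hbad z h]
      · linarith [hGabs z, hf z.1, le_abs_self (G z)]
    rw [Finset.sum_sub_distrib] at h1
    simp only [Finset.sum_const, Finset.card_univ, nsmul_eq_mul, mul_one] at h1
    rw [unifPr_eq_sum]
    have hpos : (0 : ℝ) < (Fintype.card ((Fin n → ZMod 2) × (Fin d → (Fin n → ZMod 2))) : ℝ) := by positivity
    rw [hG, le_div_iff₀ hpos] at hA
    rw [div_le_iff₀ hpos]
    linarith
  have habs : 1 - η ≤ (∑ x, |f x|) / (Fintype.card (Fin n → ZMod 2) : ℝ) := by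
    refine hA.trans ?_
    rw [hG]
    have h1 : ∑ z, G z ≤ ∑ z : (Fin n → ZMod 2) × (Fin d → (Fin n → ZMod 2)), |f z.1| :=
      Finset.sum_le_sum fun z _ => (le_abs_self _).trans (hGabs z)
    have h2 : ∑ z : (Fin n → ZMod 2) × (Fin d → (Fin n → ZMod 2)), |f z.1|
        = Fintype.card (Fin d → (Fin n → ZMod 2)) * ∑ x, |f x| := by
      rw [Fintype.sum_prod_type]
      simp only [Finset.sum_const, Finset.card_univ, nsmul_eq_mul]
      rw [← Finset.mul_sum]
    rw [h2] at h1
    rw [Fintype.card_prod, Nat.cast_mul, div_le_div_iff₀ (by positivity) (by positivity)]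
    have : (0 : ℝ) < Fintype.card (Fin n → ZMod 2) := by positivity
    nlinarith
  obtain ⟨P, hP0, hP1⟩ := exists_corrected (sgnBit f) η hpr hη
  obtain ⟨Q, hQd, hQ⟩ := exists_poly n d hd P hP0
  refine ⟨Q, hQd, ?_⟩
  simp only [hQ]
  rw [unifPr_eq_sum] at hP1
  have hpos : (0 : ℝ) < (Fintype.card (Fin n → ZMod 2) : ℝ) := by positivity
  have h1 : ∑ x, (|f x| - 2 * (if sgnBit f x ≠ P x then (1 : ℝ) else 0))
      ≤ ∑ x, f x * (-1 : ℝ) ^ (P x).val := by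
    refine Finset.sum_le_sum fun x _ => ?_
    split_ifs with h
    · have : |f x * (-1 : ℝ) ^ (P x).val| = |f x| := by simp [abs_mul]
      have h2 := neg_abs_le (f x * (-1 : ℝ) ^ (P x).val)
      rw [this] at h2
      linarith [hf x]
    · have h : sgnBit f x = P x := by simpa using h
      have h2 := sgnBit_mul f x
      rw [← h]
      have h3 : ((-1 : ℝ) ^ (sgnBit f x).val) * (-1 : ℝ) ^ (sgnBit f x).val = 1 := by
        rw [← mul_pow]; simp
      have h4 : f x * (-1 : ℝ) ^ (sgnBit f x).val = |f x| := by
        conv_lhs => rw [h2]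
        rw [mul_assoc, h3, mul_one]
      linarith
  rw [Finset.sum_sub_distrib, ← Finset.mul_sum] at h1
  rw [div_le_iff₀ hpos] at hP1
  rw [le_div_iff₀ hpos] at habs ⊢
  linarith

lemma gowersPow_abs_le (n d : ℕ) (f : (Fin n → ZMod 2) → ℝ) (hf : ∀ x, |f x| ≤ 1) :
    |gowersPow n d f| ≤ 1 := by
  unfold gowersPow
  rw [abs_div, abs_of_nonneg (a := (Fintype.card (Fin n → ZMod 2) : ℝ) * _) (by positivity)]
  rw [div_le_one (by positivity)]
  refine (Finset.abs_sum_le_sum_abs _ _).trans ?_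
  have : ∀ x : Fin n → ZMod 2, |∑ h : Fin d → (Fin n → ZMod 2),
      ∏ ω : Fin d → ZMod 2, f (x + ∑ i, ω i • h i)|
      ≤ (Fintype.card (Fin d → (Fin n → ZMod 2)) : ℝ) := by
    intro x
    refine (Finset.abs_sum_le_sum_abs _ _).trans ?_
    refine (Finset.sum_le_sum (g := fun _ => (1 : ℝ)) fun h _ => ?_).trans (by simp)
    rw [Finset.abs_prod]
    exact Finset.prod_le_one (fun _ _ => abs_nonneg _) (fun _ _ => hf _)
  refine (Finset.sum_le_sum fun x _ => this x).trans ?_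
  rw [Finset.sum_const, nsmul_eq_mul, Finset.card_univ]

end Helpers

/-- the 99%-structured inverse theorem for the Gowers norms. -/
theorem structured_inverse_theorem_99 (d : ℕ) (hd : 1 ≤ d)
    (ε : ℝ) (hε0 : 0 < ε) (hε1 : ε < 1) :
    ∃ δ : ℝ, 0 < δ ∧ δ < 1 ∧
      ∀ n : ℕ, 1 ≤ n → ∀ f : (Fin n → ZMod 2) → ℝ,
        (∀ x, f x ∈ Set.Icc (-1 : ℝ) 1) →
        1 - δ ≤ gowersNorm n d f →
        ∃ P : MvPolynomial (Fin n) (ZMod 2), P.totalDegree ≤ d - 1 ∧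
          1 - ε ≤ (∑ x : Fin n → ZMod 2,
              f x * (-1 : ℝ) ^ (MvPolynomial.eval x P).val) /
            (Fintype.card (Fin n → ZMod 2) : ℝ) := by
  have hM : (Fintype.card (Fin d → ZMod 2) : ℝ) = 2 ^ d := by
    simp [ZMod.card]
  set M : ℝ := (2 : ℝ) ^ d with hMdef
  have hM1 : 1 ≤ M := one_le_pow₀ (by norm_num)
  set η : ℝ := ε / (8 * M ^ 2) with hη
  have hηpos : 0 < η := by positivity
  have hηM : 8 * M ^ 2 * η = ε := by rw [hη]; field_simp
  have hMM : M ≤ M ^ 2 := by nlinarith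
  have hcos : Real.cos (M⁻¹ * Real.pi) < 1 := by
    rw [← Real.cos_zero]
    refine Real.cos_lt_cos_of_nonneg_of_le_pi le_rfl ?_ (by positivity)
    have : M⁻¹ ≤ 1 := inv_le_one_of_one_le₀ hM1
    nlinarith [Real.pi_pos]
  have hη1 : η < 1 := by nlinarith
  have hδM : η / M ≤ η := div_le_self hηpos.le hM1
  refine ⟨min (η / M) ((1 - Real.cos (M⁻¹ * Real.pi)) / 2), ?_, ?_, ?_⟩
  · exact lt_min (by positivity) (by linarith)
  · exact (min_le_left _ _).trans_lt (by linarith)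
  intro n hn f hf hnorm
  set δ := min (η / M) ((1 - Real.cos (M⁻¹ * Real.pi)) / 2) with hδ
  have hδ1 : δ ≤ η / M := min_le_left _ _
  have hδ2 : δ ≤ (1 - Real.cos (M⁻¹ * Real.pi)) / 2 := min_le_right _ _
  have hf' : ∀ x, |f x| ≤ 1 := fun x => abs_le.2 ⟨(hf x).1, (hf x).2⟩
  have hA1 := gowersPow_abs_le n d f hf'
  have hA : 1 - η ≤ gowersPow n d f := by
    unfold gowersNorm at hnorm
    rw [← hMdef] at hnorm
    change _ ≤ (gowersPow n d f) ^ M⁻¹ at hnorm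
    rcases lt_or_ge (gowersPow n d f) 0 with hneg | hpos
    · exfalso
      rw [Real.rpow_def_of_neg hneg] at hnorm
      have h1 : Real.exp (Real.log (gowersPow n d f) * M⁻¹) ≤ 1 := by
        rw [Real.exp_le_one_iff, ← Real.log_abs]
        exact mul_nonpos_of_nonpos_of_nonneg (Real.log_nonpos (abs_nonneg _) hA1) (by positivity)
      have h0 := Real.exp_pos (Real.log (gowersPow n d f) * M⁻¹)
      have h3 : 0 < 1 - δ := by linarith
      have h4 : 0 < Real.cos (M⁻¹ * Real.pi) := by
        by_contra hc
        nlinarith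
      nlinarith
    · have h3 : 0 ≤ 1 - δ := by linarith
      have h5 : (1 - δ) ^ (2 ^ d : ℕ) ≤ gowersPow n d f := by
        have := pow_le_pow_left₀ h3 hnorm (2 ^ d)
        rw [← Real.rpow_natCast (_ ^ M⁻¹), ← Real.rpow_mul hpos] at this
        have e : M⁻¹ * ((2 ^ d : ℕ) : ℝ) = 1 := by
          push_cast
          rw [← hMdef]
          field_simp
        rwa [e, Real.rpow_one] at this
      have h6 := one_add_mul_le_pow (a := -δ) (by linarith) (2 ^ d)
      rw [← sub_eq_add_neg 1 δ] at h6
      have h7 : M * δ ≤ η := by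
        rw [le_div_iff₀ (by positivity)] at hδ1
        linarith
      push_cast at h6
      rw [← hMdef] at h6
      linarith
  obtain ⟨P, hP, hcorr⟩ := core n d hd η f hf' (by rw [hM]; nlinarith) hA
  refine ⟨P, hP, le_trans ?_ hcorr⟩
  rw [hM]
  nlinarith
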